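/- Let K be a field with an additive valuation v : K → ℝ∞, and let I ⊆ K[x_1,…,x_n] be a weight-homogeneous ideal with respect to weights a_1,…,a_n ∈ ℤ^m. Then Z := {w ∈ X^an : μ(0,w) = w} is a closed subset of X^an, and the map X^an → X^an, w ↦ μ(0,w), is a continuous retraction of X^an onto Z (it is continuous, its image is Z, and it restricts to the identity on Z). -/

import Mathlib

open scoped Classical

noncomputable section

/-- `ℝ∞ = ℝ ∪ {∞}`, with the order topology. -/
abbrev RInf := WithTop ℝ

noncomputable instance : TopologicalSpace RInf := Preorder.topology RInf
instance : OrderTopology RInf := ⟨rfl⟩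

/-- An additive (non-Archimedean) valuation on a commutative ring, with values in
`ℝ∞`: `w(ab) = w(a) + w(b)`, `w(a+b) ≥ min (w a) (w b)`, `w 1 = 0`, `w 0 = ∞`. -/
structure IsVal {R : Type*} [CommRing R] (w : R → RInf) : Prop where
  map_mul : ∀ a b, w (a * b) = w a + w b
  min_le_add : ∀ a b, min (w a) (w b) ≤ w (a + b)
  map_one : w 1 = 0
  map_zero : w 0 = ⊤

/-- The analytification of `Spec B`: the set of additive valuations on the `K`-algebra
`B` extending the valuation `v` on `K`, as a subset of the product space `B → ℝ∞`
(topology of pointwise convergence). -/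
def An {K : Type*} [Field K] (v : K → RInf) (B : Type*) [CommRing B] [Algebra K B] :
    Set (B → RInf) :=
  {w | IsVal w ∧ ∀ c : K, w (algebraMap K B c) = v c}

variable {K : Type*} [Field K] {ι M : Type*} [Fintype M]

/-- Weight of a monomial exponent `α` with respect to weight vectors `a`. -/
def wt (a : ι → M → ℤ) (α : ι →₀ ℕ) : M → ℤ :=
  α.sum fun i k => (k : ℤ) • a i

/-- The weight-`β` component `F_β` of a polynomial `F`: the sum of the terms `c·x^α`
of `F` with `Σ_i α_i a_i = β`. -/
def wtComp (a : ι → M → ℤ) (F : MvPolynomial ι K) (β : M → ℤ) : MvPolynomial ι K :=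
  ∑ α ∈ F.support.filter (fun α => wt a α = β), MvPolynomial.monomial α (F.coeff α)

/-- An ideal is weight-homogeneous if it contains all weight components of its
members. -/
def WtHomog (a : ι → M → ℤ) (I : Ideal (MvPolynomial ι K)) : Prop :=
  ∀ F ∈ I, ∀ β : M → ℤ, wtComp a F β ∈ I

/-- Pairing `β·τ` of an integer vector with a real vector. -/
def pairR (β : M → ℤ) (τ : M → ℝ) : ℝ := ∑ j, (β j : ℝ) * τ j

/-- `ν(F) = min_β (w(F̄_β) + β·τ)`: the minimum over the finitely many `β` with
`F_β ≠ 0`, with value `∞` for `F = 0`. -/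
def muAux (a : ι → M → ℤ) (I : Ideal (MvPolynomial ι K))
    (w : (MvPolynomial ι K ⧸ I) → RInf) (τ : M → ℝ) (F : MvPolynomial ι K) : RInf :=
  (F.support.image (wt a)).inf fun β =>
    w (Ideal.Quotient.mk I (wtComp a F β)) + ((pairR β τ : ℝ) : RInf)

/-- `μ(τ,w) : B → ℝ∞`, computed on an arbitrary lift of `f` (for weight-homogeneous
`I` this is independent of the lift). -/
def mu (a : ι → M → ℤ) (I : Ideal (MvPolynomial ι K)) (τ : M → ℝ)
    (w : (MvPolynomial ι K ⧸ I) → RInf) : (MvPolynomial ι K ⧸ I) → RInf :=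
  fun f => muAux a I w τ (Function.surjInv Ideal.Quotient.mk_surjective f)

/-- The tropicalisation map `X^an → ℝ∞^ι`, `w ↦ (w(x̄_i))_i`. -/
def tropMap (I : Ideal (MvPolynomial ι K)) (w : (MvPolynomial ι K ⧸ I) → RInf) :
    ι → RInf :=
  fun i => w (Ideal.Quotient.mk I (MvPolynomial.X i))

/-- `Trop(X)`: the image of the analytification under `trop`, inside `ℝ∞^ι`. -/
def TropSet (v : K → RInf) (I : Ideal (MvPolynomial ι K)) : Set (ι → RInf) :=
  {η | ∃ w ∈ An v (MvPolynomial ι K ⧸ I), tropMap I w = η}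

/-- `Trop(X⁰)`: the points of `Trop(X)` with all coordinates finite, inside `ℝ^ι`. -/
def TropSet0 (v : K → RInf) (I : Ideal (MvPolynomial ι K)) : Set (ι → ℝ) :=
  {ξ | ∃ w ∈ An v (MvPolynomial ι K ⧸ I), ∀ i, tropMap I w i = ((ξ i : ℝ) : RInf)}

end

namespace IsVal

variable {R : Type*} [CommRing R] {w : R → RInf}

lemma le_sum (hw : IsVal w) {σ : Type*} (s : Finset σ) (f : σ → R) {c : RInf}
    (h : ∀ i ∈ s, c ≤ w (f i)) : c ≤ w (∑ i ∈ s, f i) :=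
  Finset.sum_induction f (fun x => c ≤ w x)
    (fun _ _ hx hy => (le_min hx hy).trans (hw.min_le_add _ _)) (by simp [hw.map_zero]) h

lemma lt_sum (hw : IsVal w) {σ : Type*} (s : Finset σ) (f : σ → R) {c : RInf} (hc : c < ⊤)
    (h : ∀ i ∈ s, c < w (f i)) : c < w (∑ i ∈ s, f i) :=
  Finset.sum_induction f (fun x => c < w x)
    (fun _ _ hx hy => (lt_min hx hy).trans_le (hw.min_le_add _ _)) (by simpa [hw.map_zero]) h

lemma map_neg_one (hw : IsVal w) : w (-1) = 0 := by
  have h : w (-1) + w (-1) = 0 := by rw [← hw.map_mul, neg_one_mul, neg_neg, hw.map_one]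
  induction hx : w (-1) using WithTop.recTopCoe with
  | top => simp [hx] at h
  | coe x =>
    rw [hx] at h
    norm_cast at h ⊢
    linarith

lemma map_neg (hw : IsVal w) (x : R) : w (-x) = w x := by
  rw [← neg_one_mul, hw.map_mul, hw.map_neg_one, zero_add]

lemma add_le_of_lt (hw : IsVal w) {x y : R} (h : w x < w y) : w (x + y) ≤ w x := by
  by_contra! hlt
  have := hw.min_le_add (x + y) (-y)
  rw [add_neg_cancel_right, hw.map_neg] at this
  exact (lt_min hlt h).not_ge this

end IsVal

lemma wt_eq_weight {ι M : Type*} (a : ι → M → ℤ) (α : ι →₀ ℕ) : wt a α = Finsupp.weight a α := by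
  simp [wt, Finsupp.weight_apply]

section WeightComponents

open MvPolynomial

variable {K : Type*} [Field K] {ι M : Type*} [Fintype M]

lemma wtComp_eq_weightedHomogeneousComponent (a : ι → M → ℤ) (F : MvPolynomial ι K)
    (β : M → ℤ) : wtComp a F β = weightedHomogeneousComponent a β F := by
  simp only [wtComp, wt_eq_weight, weightedHomogeneousComponent_apply]

lemma wtComp_eq_zero (a : ι → M → ℤ) (F : MvPolynomial ι K) {β : M → ℤ}
    (h : β ∉ F.support.image (wt a)) : wtComp a F β = 0 := by
  rw [wtComp, Finset.filter_false_of_mem, Finset.sum_empty]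
  exact fun α hα he => h (Finset.mem_image.2 ⟨α, hα, he⟩)

lemma isWeightedHomogeneous_wtComp (a : ι → M → ℤ) (F : MvPolynomial ι K) (β : M → ℤ) :
    IsWeightedHomogeneous a (wtComp a F β) β := by
  rw [wtComp_eq_weightedHomogeneousComponent]
  exact weightedHomogeneousComponent_isWeightedHomogeneous _ _

lemma wtComp_of_isWeightedHomogeneous (a : ι → M → ℤ) {F : MvPolynomial ι K} {β : M → ℤ}
    (h : IsWeightedHomogeneous a F β) (γ : M → ℤ) :
    wtComp a F γ = if γ = β then F else 0 := by
  rw [wtComp_eq_weightedHomogeneousComponent]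
  exact weightedHomogeneousComponent_of_mem h

lemma sum_wtComp (a : ι → M → ℤ) (F : MvPolynomial ι K) :
    ∑ β ∈ F.support.image (wt a), wtComp a F β = F := by
  conv_rhs => rw [F.as_sum]
  exact Finset.sum_fiberwise_of_maps_to (fun α hα => Finset.mem_image_of_mem _ hα) _

lemma wtComp_mul (a : ι → M → ℤ) (F G : MvPolynomial ι K) (δ : M → ℤ) :
    wtComp a (F * G) δ =
      ∑ p ∈ (F.support.image (wt a) ×ˢ G.support.image (wt a)).filter
        (fun p => p.1 + p.2 = δ), wtComp a F p.1 * wtComp a G p.2 := by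
  conv_lhs => rw [← sum_wtComp a F, ← sum_wtComp a G, Finset.sum_mul_sum,
    ← Finset.sum_product', wtComp_eq_weightedHomogeneousComponent, map_sum]
  rw [Finset.sum_filter]
  refine Finset.sum_congr rfl fun p _ => ?_
  rw [← wtComp_eq_weightedHomogeneousComponent, wtComp_of_isWeightedHomogeneous a
    ((isWeightedHomogeneous_wtComp a F p.1).mul (isWeightedHomogeneous_wtComp a G p.2))]
  simp only [eq_comm]

end WeightComponents

section Mu

open MvPolynomial

variable {K : Type*} [Field K] {ι M : Type*} [Fintype M] {a : ι → M → ℤ}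
  {I : Ideal (MvPolynomial ι K)} {w : (MvPolynomial ι K ⧸ I) → RInf}

lemma muAux_zero_eq (F : MvPolynomial ι K) :
    muAux a I w 0 F =
      (F.support.image (wt a)).inf fun β => w (Ideal.Quotient.mk I (wtComp a F β)) := by
  simp [muAux, pairR]

lemma le_muAux_zero_iff (hw : IsVal w) (F : MvPolynomial ι K) (c : RInf) :
    c ≤ muAux a I w 0 F ↔ ∀ β, c ≤ w (Ideal.Quotient.mk I (wtComp a F β)) := by
  rw [muAux_zero_eq, Finset.le_inf_iff]
  refine ⟨fun h β => ?_, fun h β _ => h β⟩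
  by_cases hβ : β ∈ F.support.image (wt a)
  · exact h β hβ
  · simp [wtComp_eq_zero a F hβ, hw.map_zero]

lemma mk_wtComp_congr (hI : WtHomog a I) {F G : MvPolynomial ι K}
    (h : Ideal.Quotient.mk I F = Ideal.Quotient.mk I G) (β : M → ℤ) :
    Ideal.Quotient.mk I (wtComp a F β) = Ideal.Quotient.mk I (wtComp a G β) := by
  rw [Ideal.Quotient.eq] at h ⊢
  simpa [wtComp_eq_weightedHomogeneousComponent] using hI _ h β

lemma le_mu_zero_iff (hI : WtHomog a I) (hw : IsVal w) (F : MvPolynomial ι K) (c : RInf) :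
    c ≤ mu a I 0 w (Ideal.Quotient.mk I F) ↔
      ∀ β, c ≤ w (Ideal.Quotient.mk I (wtComp a F β)) := by
  rw [mu, le_muAux_zero_iff hw]
  exact forall_congr' fun β => by
    rw [mk_wtComp_congr hI (Function.surjInv_eq Ideal.Quotient.mk_surjective _) β]

lemma mu_zero_le (hI : WtHomog a I) (hw : IsVal w) (F : MvPolynomial ι K) (β : M → ℤ) :
    mu a I 0 w (Ideal.Quotient.mk I F) ≤ w (Ideal.Quotient.mk I (wtComp a F β)) :=
  (le_mu_zero_iff hI hw F _).1 le_rfl β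

lemma mu_zero_of_isWeightedHomogeneous (hI : WtHomog a I) (hw : IsVal w)
    {F : MvPolynomial ι K} {β : M → ℤ} (h : IsWeightedHomogeneous a F β) :
    mu a I 0 w (Ideal.Quotient.mk I F) = w (Ideal.Quotient.mk I F) := by
  refine eq_of_forall_le_iff fun c => ?_
  simp only [le_mu_zero_iff hI hw, wtComp_of_isWeightedHomogeneous a h]
  refine ⟨fun hc => by simpa using hc β, fun hc γ => ?_⟩
  split_ifs
  · exact hc
  · simp [hw.map_zero]

lemma exists_mu_zero_eq (hI : WtHomog a I) (hw : IsVal w) (F : MvPolynomial ι K)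
    (h : mu a I 0 w (Ideal.Quotient.mk I F) ≠ ⊤) :
    ∃ β ∈ F.support.image (wt a),
      w (Ideal.Quotient.mk I (wtComp a F β)) = mu a I 0 w (Ideal.Quotient.mk I F) := by
  have hmu : mu a I 0 w (Ideal.Quotient.mk I F) =
      (F.support.image (wt a)).inf fun β => w (Ideal.Quotient.mk I (wtComp a F β)) :=
    eq_of_forall_le_iff fun c => by
      rw [le_mu_zero_iff hI hw, ← muAux_zero_eq, le_muAux_zero_iff hw]
  have hne : (F.support.image (wt a)).Nonempty := by
    rw [Finset.nonempty_iff_ne_empty]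
    intro he
    rw [hmu, he] at h
    exact h rfl
  obtain ⟨β, hβ, he⟩ := Finset.exists_mem_eq_inf _ hne
    fun β => w (Ideal.Quotient.mk I (wtComp a F β))
  exact ⟨β, hβ, by rw [hmu, he]⟩

lemma mu_zero_mul_le (hI : WtHomog a I) (hw : IsVal w) (F G : MvPolynomial ι K) :
    mu a I 0 w (Ideal.Quotient.mk I (F * G)) ≤
      mu a I 0 w (Ideal.Quotient.mk I F) + mu a I 0 w (Ideal.Quotient.mk I G) := by
  by_cases hF : mu a I 0 w (Ideal.Quotient.mk I F) = ⊤
  · simp [hF]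
  by_cases hG : mu a I 0 w (Ideal.Quotient.mk I G) = ⊤
  · simp [hG]
  have hne {F : MvPolynomial ι K} (hF : mu a I 0 w (Ideal.Quotient.mk I F) ≠ ⊤) :
      ((F.support.image (wt a)).filter fun β => w (Ideal.Quotient.mk I (wtComp a F β)) =
        mu a I 0 w (Ideal.Quotient.mk I F)).Nonempty := by
    obtain ⟨β, hβ⟩ := exists_mu_zero_eq hI hw F hF
    exact ⟨β, Finset.mem_filter.2 hβ⟩
  obtain ⟨β, hβ, γ, hγ, hu⟩ := UniqueSums.uniqueAdd_of_nonempty (hne hF) (hne hG)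
  rw [Finset.mem_filter] at hβ hγ
  refine (mu_zero_le hI hw (F * G) (β + γ)).trans ?_
  have hmem : (β, γ) ∈ (F.support.image (wt a) ×ˢ G.support.image (wt a)).filter
      (fun p => p.1 + p.2 = β + γ) := by
    rw [Finset.mem_filter, Finset.mem_product]
    exact ⟨⟨hβ.1, hγ.1⟩, rfl⟩
  have hlead : w (Ideal.Quotient.mk I (wtComp a F β * wtComp a G γ)) =
      mu a I 0 w (Ideal.Quotient.mk I F) + mu a I 0 w (Ideal.Quotient.mk I G) := by
    rw [map_mul, hw.map_mul, hβ.2, hγ.2]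
  rw [wtComp_mul, ← Finset.add_sum_erase _ _ hmem, map_add, map_sum, ← hlead]
  refine hw.add_le_of_lt (hw.lt_sum _ _ ?_ ?_)
  · rw [hlead]
    exact WithTop.add_lt_top.2 ⟨Ne.lt_top hF, Ne.lt_top hG⟩
  · rintro ⟨β', γ'⟩ hp
    rw [Finset.mem_erase, Finset.mem_filter, Finset.mem_product] at hp
    obtain ⟨hpne, ⟨hβ', hγ'⟩, hsum⟩ := hp
    rw [hlead, map_mul, hw.map_mul]
    have hleF := mu_zero_le hI hw F β'
    have hleG := mu_zero_le hI hw G γ'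
    rcases hleF.eq_or_lt with heF | hltF
    · rcases hleG.eq_or_lt with heG | hltG
      · obtain ⟨rfl, rfl⟩ := hu (Finset.mem_filter.2 ⟨hβ', heF.symm⟩)
          (Finset.mem_filter.2 ⟨hγ', heG.symm⟩) hsum
        exact absurd rfl hpne
      · rw [← heF]
        exact WithTop.add_lt_add_left hF hltG
    · exact WithTop.add_lt_add_of_lt_of_le hG hltF hleG

theorem isVal_mu_zero (hI : WtHomog a I) (hw : IsVal w) : IsVal (mu a I 0 w) where
  map_mul x y := by
    obtain ⟨F, rfl⟩ := Ideal.Quotient.mk_surjective x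
    obtain ⟨G, rfl⟩ := Ideal.Quotient.mk_surjective y
    rw [← map_mul]
    refine (mu_zero_mul_le hI hw F G).antisymm ?_
    rw [le_mu_zero_iff hI hw]
    intro δ
    rw [wtComp_mul, map_sum]
    refine hw.le_sum _ _ fun p _ => ?_
    rw [map_mul, hw.map_mul]
    exact add_le_add (mu_zero_le hI hw F p.1) (mu_zero_le hI hw G p.2)
  min_le_add x y := by
    obtain ⟨F, rfl⟩ := Ideal.Quotient.mk_surjective x
    obtain ⟨G, rfl⟩ := Ideal.Quotient.mk_surjective y
    rw [← map_add, le_mu_zero_iff hI hw]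
    intro β
    rw [wtComp_eq_weightedHomogeneousComponent, map_add, map_add,
      ← wtComp_eq_weightedHomogeneousComponent, ← wtComp_eq_weightedHomogeneousComponent]
    exact (min_le_min (mu_zero_le hI hw F β) (mu_zero_le hI hw G β)).trans
      (hw.min_le_add _ _)
  map_one := by
    rw [← map_one (Ideal.Quotient.mk I),
      mu_zero_of_isWeightedHomogeneous hI hw (isWeightedHomogeneous_one K a), map_one, hw.map_one]
  map_zero := by
    rw [← map_zero (Ideal.Quotient.mk I),
      mu_zero_of_isWeightedHomogeneous hI hw (isWeightedHomogeneous_zero K a 0), map_zero,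
      hw.map_zero]

theorem mu_zero_mem_An {v : K → RInf} (hI : WtHomog a I)
    (hw : w ∈ An v (MvPolynomial ι K ⧸ I)) : mu a I 0 w ∈ An v (MvPolynomial ι K ⧸ I) := by
  refine ⟨isVal_mu_zero hI hw.1, fun c => ?_⟩
  rw [← hw.2 c]
  exact mu_zero_of_isWeightedHomogeneous hI hw.1 (isWeightedHomogeneous_C a c)

theorem mu_zero_mu_zero (hI : WtHomog a I) (hw : IsVal w) :
    mu a I 0 (mu a I 0 w) = mu a I 0 w := by
  funext x
  obtain ⟨F, rfl⟩ := Ideal.Quotient.mk_surjective x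
  refine eq_of_forall_le_iff fun c => ?_
  rw [le_mu_zero_iff hI (isVal_mu_zero hI hw), le_mu_zero_iff hI hw]
  simp only [mu_zero_of_isWeightedHomogeneous hI hw (isWeightedHomogeneous_wtComp a F _)]

theorem continuous_mu_zero (a : ι → M → ℤ) (I : Ideal (MvPolynomial ι K)) :
    Continuous (mu a I 0) := by
  refine continuous_pi fun x => ?_
  simp only [mu, muAux_zero_eq]
  exact Continuous.finset_inf_apply fun β _ => continuous_apply _

end Mu

/-- `Z = {w ∈ X^an : μ(0,w) = w}` is closed in `X^an`, and
`w ↦ μ(0,w)` is a continuous retraction of `X^an` onto `Z`. -/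
theorem Z_closed_and_retraction
    {K : Type*} [Field K] (v : K → RInf) (hv : IsVal v)
    {n m : ℕ} (a : Fin n → Fin m → ℤ)
    (I : Ideal (MvPolynomial (Fin n) K)) (hI : WtHomog a I) :
    -- `Z` is closed in `X^an`
    IsClosed {w : {w : (MvPolynomial (Fin n) K ⧸ I) → RInf //
        w ∈ An v (MvPolynomial (Fin n) K ⧸ I)} | mu a I 0 w.val = w.val} ∧
    -- `w ↦ μ(0,w)` is continuous on `X^an`
    Continuous (fun w : {w : (MvPolynomial (Fin n) K ⧸ I) → RInf //
        w ∈ An v (MvPolynomial (Fin n) K ⧸ I)} => mu a I 0 w.val) ∧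
    -- its image is exactly `Z`
    (Set.range (fun w : {w : (MvPolynomial (Fin n) K ⧸ I) → RInf //
        w ∈ An v (MvPolynomial (Fin n) K ⧸ I)} => mu a I 0 w.val) =
      {ω : (MvPolynomial (Fin n) K ⧸ I) → RInf |
        ω ∈ An v (MvPolynomial (Fin n) K ⧸ I) ∧ mu a I 0 ω = ω}) ∧
    -- it restricts to the identity on `Z`
    (∀ w : (MvPolynomial (Fin n) K ⧸ I) → RInf,
      w ∈ An v (MvPolynomial (Fin n) K ⧸ I) → mu a I 0 w = w → mu a I 0 w = w) := by
  have hcont : Continuous (fun w : {w : (MvPolynomial (Fin n) K ⧸ I) → RInf //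
      w ∈ An v (MvPolynomial (Fin n) K ⧸ I)} => mu a I 0 w.val) :=
    (continuous_mu_zero a I).comp continuous_subtype_val
  refine ⟨isClosed_eq hcont continuous_subtype_val, hcont, ?_, fun _ _ h => h⟩
  ext ω
  constructor
  · rintro ⟨w, rfl⟩
    exact ⟨mu_zero_mem_An hI w.2, mu_zero_mu_zero hI w.2.1⟩
  · rintro ⟨hω, he⟩
    exact ⟨⟨ω, hω⟩, he⟩
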